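/- arXiv:math/0210031 — 2 statements merged into one kernel-verified Lean document; each statement's English description precedes it below -/
import Mathlib

section
/- For any two comparable probability measures μ and μ' on a measurable space E (i.e., there exist positive scalars α, β with αμ ≤ μ' ≤ βμ), the total variation distance satisfies ‖μ − μ'‖_tv ≤ (2/log 3) · h(μ, μ'), where h is the Hilbert projective metric h(μ,μ') = log(‖dμ/dμ'‖_∞ · ‖dμ'/dμ‖_∞). -/
open MeasureTheory ENNReal
open scoped NNReal

/-- Total variation distance: `‖μ − ν‖_tv = 2 sup_A |μ(A) − ν(A)|`. -/
noncomputable def tvDist {E : Type*} [MeasurableSpace E] (μ ν : Measure E) : ℝ :=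
  2 * ⨆ A : {s : Set E // MeasurableSet s}, |(μ A.1).toReal - (ν A.1).toReal|

/-- Two nonnegative measures are comparable if `αμ ≤ ν ≤ βμ` for positive scalars. -/
def Comparable {E : Type*} [MeasurableSpace E] (μ ν : Measure E) : Prop :=
  ∃ a b : ℝ≥0, 0 < a ∧ 0 < b ∧ a • μ ≤ ν ∧ ν ≤ b • μ

/-- Hilbert projective metric
`h(μ,ν) = log( sup_A μ(A)/ν(A) · sup_A ν(A)/μ(A) )`. -/
noncomputable def hilbertDist {E : Type*} [MeasurableSpace E] (μ ν : Measure E) : ℝ :=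
  Real.log (((⨆ A : {s : Set E // MeasurableSet s}, μ A.1 / ν A.1) *
    (⨆ A : {s : Set E // MeasurableSet s}, ν A.1 / μ A.1)).toReal)

theorem tv_aux {E : Type*} [MeasurableSpace E] (μ ν : Measure E)
    [IsProbabilityMeasure μ] [IsProbabilityMeasure ν] (c : ℝ≥0) (h : μ ≤ c • ν) :
    0 < (⨆ A : {s : Set E // MeasurableSet s}, μ A.1 / ν A.1).toReal ∧
    ∀ A : Set E, MeasurableSet A → |(μ A).toReal - (ν A).toReal| ≤
      Real.log (⨆ A : {s : Set E // MeasurableSet s}, μ A.1 / ν A.1).toReal := by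
  set M := ⨆ A : {s : Set E // MeasurableSet s}, μ A.1 / ν A.1 with hM
  have hc : ∀ A, μ A ≤ c * ν A := fun A => by
    have := h A
    rw [Measure.smul_apply, ENNReal.smul_def, smul_eq_mul] at this
    exact this
  have hMc : M ≤ c := iSup_le fun A => ENNReal.div_le_of_le_mul (hc A.1)
  have hMtop : M ≠ ∞ := ne_top_of_le_ne_top ENNReal.coe_ne_top hMc
  have hM1 : 1 ≤ M := by
    have := le_iSup (fun A : {s : Set E // MeasurableSet s} => μ A.1 / ν A.1)
      ⟨Set.univ, MeasurableSet.univ⟩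
    simpa using this
  have hm1 : 1 ≤ M.toReal := by
    have := ENNReal.toReal_mono hMtop hM1
    simpa using this
  have hle : ∀ A, MeasurableSet A → μ A ≤ M * ν A := by
    intro A hA
    by_cases h0 : ν A = 0
    · have := hc A
      simpa [h0] using this
    · have := le_iSup (fun A : {s : Set E // MeasurableSet s} => μ A.1 / ν A.1) ⟨A, hA⟩
      exact (ENNReal.div_le_iff h0 (measure_ne_top ν A)).1 this
  have key : ∀ A, MeasurableSet A → μ.real A - ν.real A ≤ Real.log M.toReal := by
    intro A hA
    have h1 : μ.real A ≤ M.toReal * ν.real A := by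
      have := ENNReal.toReal_mono (ENNReal.mul_ne_top hMtop (measure_ne_top ν A)) (hle A hA)
      simpa [Measure.real, ENNReal.toReal_mul] using this
    have hp : μ.real A ≤ 1 := measureReal_le_one
    have h2 := Real.one_sub_inv_le_log_of_pos (show 0 < M.toReal by linarith)
    have h3 : M.toReal⁻¹ * μ.real A ≤ ν.real A := by
      rw [inv_mul_le_iff₀ (by linarith)]; exact h1
    have h4 : M.toReal⁻¹ ≤ 1 := inv_le_one_of_one_le₀ hm1
    nlinarith
  refine ⟨by linarith, fun A hA => ?_⟩
  have h1 := key A hA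
  have h2 := key Aᶜ hA.compl
  rw [probReal_compl_eq_one_sub hA, probReal_compl_eq_one_sub hA] at h2
  change |μ.real A - ν.real A| ≤ _
  rw [abs_le]
  constructor <;> linarith

/-- for comparable probability measures,
`‖μ − μ'‖_tv ≤ (2 / log 3) · h(μ, μ')`. -/
theorem tv_le_hilbert {E : Type*} [MeasurableSpace E] (μ μ' : Measure E)
    [IsProbabilityMeasure μ] [IsProbabilityMeasure μ'] (hcomp : Comparable μ μ') :
    tvDist μ μ' ≤ (2 / Real.log 3) * hilbertDist μ μ' := by
  obtain ⟨a, b, ha, hb, h1, h2⟩ := hcomp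
  have h1' : μ ≤ a⁻¹ • μ' := by
    intro A
    have := h1 A
    simp only [Measure.smul_apply] at this ⊢
    calc μ A = a⁻¹ • (a • μ A) := by rw [smul_smul, inv_mul_cancel₀ ha.ne', one_smul]
      _ ≤ a⁻¹ • μ' A := by
        simp only [ENNReal.smul_def, smul_eq_mul] at this ⊢
        gcongr
  obtain ⟨hM, hMA⟩ := tv_aux μ μ' _ h1'
  obtain ⟨hN, hNA⟩ := tv_aux μ' μ _ h2
  unfold tvDist hilbertDist
  rw [ENNReal.toReal_mul, Real.log_mul hM.ne' hN.ne']
  have hl0 : 0 < Real.log 3 := Real.log_pos (by norm_num)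
  have hl2 : Real.log 3 ≤ 2 := by
    have := Real.log_le_sub_one_of_pos (show (0 : ℝ) < 3 by norm_num)
    linarith
  rw [div_mul_eq_mul_div, mul_div_assoc]
  refine mul_le_mul_of_nonneg_left ?_ (by norm_num)
  haveI : Nonempty {s : Set E // MeasurableSet s} := ⟨⟨∅, MeasurableSet.empty⟩⟩
  refine ciSup_le fun A => ?_
  rw [le_div_iff₀ hl0]
  have e1 := hMA A.1 A.2
  have e2 := hNA A.1 A.2
  rw [abs_sub_comm] at e2
  nlinarith [abs_nonneg ((μ A.1).toReal - (μ' A.1).toReal)]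
end

section
/- Let K_α be a mixing Markov kernel with constant ε ∈ (0,1] and let K^α_{k+1,n} denote the composition of the (random) normalized filter transition maps K^α_{k+1} ∘ ⋯ ∘ K^α_n, where each K^α_j maps a probability measure μ to K^α_j(μ)(dx) = ∫ g_j(x) K_α(x',dx) μ(dx') / ∫∫ g_j(z) K_α(z',dz) μ(dz') for strictly positive bounded functions g_j. Then the Birkhoff contraction coefficient of the n−k-fold composition satisfies τ(K^α_{k+1,n}) ≤ ((1−ε²)/(1+ε²))^{n−k}. -/
open MeasureTheory ENNReal ProbabilityTheory
open scoped NNReal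

noncomputable def birkhoffCoeff {E : Type*} [MeasurableSpace E]
    (T : Measure E → Measure E) : ℝ :=
  sSup {r : ℝ | ∃ μ ν : Measure E, IsFiniteMeasure μ ∧ IsFiniteMeasure ν ∧
    Comparable μ ν ∧ 0 < hilbertDist μ ν ∧ r = hilbertDist (T μ) (T ν) / hilbertDist μ ν}

def IsMixing {E : Type*} [MeasurableSpace E] (K : Kernel E E) (ε : ℝ) : Prop :=
  ∃ lam : Measure E, IsFiniteMeasure lam ∧ lam ≠ 0 ∧
    ∀ x : E, ∀ A : Set E, MeasurableSet A →
      ENNReal.ofReal ε * lam A ≤ K x A ∧ K x A ≤ ENNReal.ofReal ε⁻¹ * lam A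

/-- The normalized filter transition map
`K_j(μ)(dx) = ∫ g_j(x) K(x',dx) μ(dx') / ∫∫ g_j(z) K(z',dz) μ(dz')`. -/
noncomputable def filterStep {E : Type*} [MeasurableSpace E]
    (K : Kernel E E) (g : E → ℝ) (μ : Measure E) : Measure E :=
  ((((μ.bind (fun x => K x)).withDensity fun x => ENNReal.ofReal (g x)) Set.univ)⁻¹) •
    ((μ.bind (fun x => K x)).withDensity fun x => ENNReal.ofReal (g x))

/-- The composition `K_{k+1,n} = K_{k+1} ∘ ⋯ ∘ K_n` of filter transition maps. -/
noncomputable def filterComp {E : Type*} [MeasurableSpace E]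
    (K : Kernel E E) (g : ℕ → E → ℝ) (k n : ℕ) (μ : Measure E) : Measure E :=
  (List.range (n - k)).foldl (fun m j => filterStep K (g (k + 1 + j)) m) μ

/-- Two measures are within projective ratio `s`. -/
def ProjRatio {E : Type*} [MeasurableSpace E] (μ ν : Measure E) (s : ℝ) : Prop :=
  ∃ a b : ℝ, 0 < a ∧ a ≤ b ∧ b ≤ s * a ∧
    ∀ A : Set E, MeasurableSet A → a * μ.real A ≤ ν.real A ∧ ν.real A ≤ b * μ.real A

lemma hilbertDist_le_of_projRatio {E : Type*} [MeasurableSpace E] {μ ν : Measure E}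
    [IsFiniteMeasure μ] [IsFiniteMeasure ν] {s : ℝ} (h : ProjRatio μ ν s) :
    hilbertDist μ ν ≤ Real.log s := by
  obtain ⟨a, b, ha, hab, hs, H⟩ := h
  have hb : 0 < b := ha.trans_le hab
  have hs1 : 1 ≤ s := by
    by_contra hc
    push Not at hc
    nlinarith
  have e1 : (⨆ A : {s : Set E // MeasurableSet s}, μ A.1 / ν A.1) ≤ ENNReal.ofReal a⁻¹ := by
    refine iSup_le fun A => ENNReal.div_le_of_le_mul ?_
    rw [← ofReal_measureReal (μ := μ), ← ofReal_measureReal (μ := ν),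
      ← ENNReal.ofReal_mul (by positivity)]
    apply ENNReal.ofReal_le_ofReal
    rw [inv_mul_eq_div, le_div_iff₀ ha, mul_comm]
    exact (H A.1 A.2).1
  have e2 : (⨆ A : {s : Set E // MeasurableSet s}, ν A.1 / μ A.1) ≤ ENNReal.ofReal b := by
    refine iSup_le fun A => ENNReal.div_le_of_le_mul ?_
    rw [← ofReal_measureReal (μ := μ), ← ofReal_measureReal (μ := ν),
      ← ENNReal.ofReal_mul (by positivity)]
    exact ENNReal.ofReal_le_ofReal (H A.1 A.2).2
  have e3 := mul_le_mul' e1 e2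
  rw [← ENNReal.ofReal_mul (by positivity)] at e3
  have e4 := ENNReal.toReal_le_of_le_ofReal (by positivity) e3
  have e5 : a⁻¹ * b ≤ s := by rw [inv_mul_eq_div, div_le_iff₀ ha]; exact hs
  unfold hilbertDist
  rcases (ENNReal.toReal_nonneg (a := (⨆ A : {s : Set E // MeasurableSet s}, μ A.1 / ν A.1) *
    (⨆ A : {s : Set E // MeasurableSet s}, ν A.1 / μ A.1))).eq_or_lt with h0 | h0
  · rw [← h0, Real.log_zero]; exact Real.log_nonneg hs1
  · exact Real.log_le_log h0 (e4.trans e5)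

lemma projRatio_of_hilbertDist_pos {E : Type*} [MeasurableSpace E] {μ ν : Measure E}
    [IsFiniteMeasure μ] [IsFiniteMeasure ν] (h : 0 < hilbertDist μ ν) :
    ProjRatio μ ν (Real.exp (hilbertDist μ ν)) ∧ μ ≠ 0 ∧ ν ≠ 0 := by
  unfold hilbertDist at h ⊢
  set S := (⨆ A : {s : Set E // MeasurableSet s}, μ A.1 / ν A.1) with hS
  set T := (⨆ A : {s : Set E // MeasurableSet s}, ν A.1 / μ A.1) with hT
  have hpos : 0 < (S * T).toReal := by
    rcases (ENNReal.toReal_nonneg (a := S * T)).eq_or_lt with h0 | h0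
    · rw [← h0, Real.log_zero] at h; exact absurd h (lt_irrefl _)
    · exact h0
  rw [Real.exp_log hpos]
  have hpos' := hpos
  rw [ENNReal.toReal_mul] at hpos'
  have hS0 : 0 < S.toReal := by
    rcases (ENNReal.toReal_nonneg (a := S)).eq_or_lt with h0 | h0
    · rw [← h0] at hpos'; simp at hpos'
    · exact h0
  have hT0 : 0 < T.toReal := by
    rcases (ENNReal.toReal_nonneg (a := T)).eq_or_lt with h0 | h0
    · rw [← h0] at hpos'; simp at hpos'
    · exact h0
  have hSt : S ≠ ∞ := (ENNReal.toReal_pos_iff.1 hS0).2.ne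
  have hTt : T ≠ ∞ := (ENNReal.toReal_pos_iff.1 hT0).2.ne
  have hμ : μ ≠ 0 := by
    rintro rfl
    have : S = 0 := by simp [hS]
    rw [this] at hS0; simp at hS0
  have hν : ν ≠ 0 := by
    rintro rfl
    have : T = 0 := by simp [hT]
    rw [this] at hT0; simp at hT0
  have H1 : ∀ A, MeasurableSet A → μ.real A ≤ S.toReal * ν.real A := by
    intro A hA
    have : μ A / ν A ≤ S := le_iSup (fun A : {s : Set E // MeasurableSet s} => μ A.1 / ν A.1) ⟨A, hA⟩
    have := (ENNReal.div_le_iff_le_mul (Or.inr hSt) (Or.inl (measure_ne_top _ _))).1 this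
    have := ENNReal.toReal_mono (ENNReal.mul_ne_top hSt (measure_ne_top _ _)) this
    rwa [ENNReal.toReal_mul] at this
  have H2 : ∀ A, MeasurableSet A → ν.real A ≤ T.toReal * μ.real A := by
    intro A hA
    have : ν A / μ A ≤ T := le_iSup (fun A : {s : Set E // MeasurableSet s} => ν A.1 / μ A.1) ⟨A, hA⟩
    have := (ENNReal.div_le_iff_le_mul (Or.inr hTt) (Or.inl (measure_ne_top _ _))).1 this
    have := ENNReal.toReal_mono (ENNReal.mul_ne_top hTt (measure_ne_top _ _)) this
    rwa [ENNReal.toReal_mul] at this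
  have H1' : ∀ A, MeasurableSet A → S.toReal⁻¹ * μ.real A ≤ ν.real A := by
    intro A hA
    rw [inv_mul_eq_div, div_le_iff₀ hS0, mul_comm]
    exact H1 A hA
  refine ⟨⟨S.toReal⁻¹, T.toReal, inv_pos.2 hS0, ?_, ?_, fun A hA => ⟨H1' A hA, H2 A hA⟩⟩, hμ, hν⟩
  · have hm : 0 < μ.real Set.univ := by
      rw [measureReal_def, ENNReal.toReal_pos_iff]
      exact ⟨by simpa [pos_iff_ne_zero] using hμ, measure_lt_top _ _⟩
    exact le_of_mul_le_mul_right
      ((H1' _ MeasurableSet.univ).trans (H2 _ MeasurableSet.univ)) hm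
  · rw [ENNReal.toReal_mul]
    field_simp
    rfl

/-- The scalar inequality behind Birkhoff's contraction theorem. -/
lemma birkhoff_scalar {e s P Q : ℝ} (he : 0 < e) (he1 : e ≤ 1) (hs : 1 ≤ s) (hP : 0 ≤ P)
    (hQ : 0 ≤ Q) (hPQ : 0 < P + Q) :
    (s * P + e * Q) * (e * P + Q) ≤ s ^ ((1 - e) / (1 + e)) * ((P + e * Q) * (s * e * P + Q)) := by
  set r := (1 - e) / (1 + e) with hr
  have p1 : ∀ y : ℝ, 1 ≤ y → 0 < y * P + e * Q := by
    intro y hy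
    rcases hP.eq_or_lt with h | h
    · subst h; have : 0 < Q := by linarith
      positivity
    · positivity
  have p2 : ∀ y : ℝ, 1 ≤ y → 0 < y * e * P + Q := by
    intro y hy
    rcases hP.eq_or_lt with h | h
    · subst h; have : 0 < Q := by linarith
      linarith
    · positivity
  let f : ℝ → ℝ := fun y => r * Real.log y - Real.log (y * P + e * Q) + Real.log (y * e * P + Q)
  have hd : ∀ y : ℝ, 1 ≤ y → HasDerivAt f
      (r * y⁻¹ - P / (y * P + e * Q) + (e * P) / (y * e * P + Q)) y := by
    intro y hy
    have h1 : HasDerivAt (fun y : ℝ => y * P + e * Q) P y := by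
      simpa using ((hasDerivAt_id y).mul_const P).add_const (e * Q)
    have h2 : HasDerivAt (fun y : ℝ => y * e * P + Q) (e * P) y := by
      simpa using (((hasDerivAt_id y).mul_const e).mul_const P).add_const Q
    exact (((Real.hasDerivAt_log (by linarith)).const_mul r).sub
      (h1.log (p1 y hy).ne')).add (h2.log (p2 y hy).ne')
  have hm : MonotoneOn f (Set.Ici 1) := by
    refine monotoneOn_of_deriv_nonneg (convex_Ici 1)
      (fun y hy => (hd y hy).continuousAt.continuousWithinAt)
      (fun y hy => ?_) (fun y hy => ?_)
    · rw [interior_Ici] at hy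
      exact (hd y (le_of_lt hy)).differentiableAt.differentiableWithinAt
    · rw [interior_Ici] at hy
      have hy : 1 < y := hy
      rw [(hd y hy.le).deriv]
      have a1 := p1 y hy.le
      have a2 := p2 y hy.le
      have key : r * y⁻¹ - P / (y * P + e * Q) + (e * P) / (y * e * P + Q)
          = (1 - e) * e * (y * P - Q) ^ 2 /
            ((1 + e) * y * (y * P + e * Q) * (y * e * P + Q)) := by
        rw [hr]
        have : y ≠ 0 := by linarith
        have a3 : e * y * P + Q ≠ 0 := by rw [mul_comm e y]; exact a2.ne'
        have a4 : y * P * e + Q ≠ 0 := by rw [mul_right_comm y P e]; exact a2.ne'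
        field_simp
        ring
      rw [key]
      have : 0 ≤ 1 - e := by linarith
      positivity
  have h := hm (Set.mem_Ici.2 le_rfl) (Set.mem_Ici.2 hs) hs
  simp only [f, Real.log_one, mul_zero, one_mul] at h
  have q1 := p1 s hs
  have q2 := p2 s hs
  have q3 := p1 1 le_rfl
  have q4 := p2 1 le_rfl
  rw [one_mul] at q3 q4
  have hs0 : 0 < s := by linarith
  have hsr : 0 < s ^ r := Real.rpow_pos_of_pos hs0 r
  rw [← Real.log_le_log_iff (by positivity) (by positivity), Real.log_mul q1.ne' q4.ne',
    Real.log_mul hsr.ne' (by positivity), Real.log_mul q3.ne' q2.ne', Real.log_rpow hs0]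
  linarith

/-- The unnormalized update. -/
noncomputable def unnormStep {E : Type*} [MeasurableSpace E]
    (K : Kernel E E) (g : E → ℝ) (μ : Measure E) : Measure E :=
  (μ.bind (fun x => K x)).withDensity fun x => ENNReal.ofReal (g x)

lemma unnormStep_apply {E : Type*} [MeasurableSpace E]
    (K : Kernel E E) {g : E → ℝ} (hg : Measurable g) (μ : Measure E) {A : Set E}
    (hA : MeasurableSet A) :
    unnormStep K g μ A = ∫⁻ x, ∫⁻ z in A, ENNReal.ofReal (g z) ∂(K x) ∂μ := by
  unfold unnormStep
  rw [withDensity_apply _ hA, ← lintegral_indicator hA,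
    Measure.lintegral_bind K.measurable.aemeasurable
      ((hg.ennreal_ofReal.indicator hA).aemeasurable)]
  simp_rw [lintegral_indicator hA]

lemma unnormStep_add {E : Type*} [MeasurableSpace E]
    (K : Kernel E E) {g : E → ℝ} (hg : Measurable g) (μ ν : Measure E) {A : Set E}
    (hA : MeasurableSet A) :
    unnormStep K g (μ + ν) A = unnormStep K g μ A + unnormStep K g ν A := by
  simp_rw [unnormStep_apply K hg _ hA, lintegral_add_measure]

lemma unnormStep_smul {E : Type*} [MeasurableSpace E]
    (K : Kernel E E) {g : E → ℝ} (hg : Measurable g) (c : ℝ≥0) (μ : Measure E) {A : Set E}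
    (hA : MeasurableSet A) :
    unnormStep K g (c • μ) A = c * unnormStep K g μ A := by
  simp_rw [unnormStep_apply K hg _ hA, lintegral_smul_measure]
  rfl

lemma unnormStep_finite {E : Type*} [MeasurableSpace E]
    (K : Kernel E E) [IsMarkovKernel K] {g : E → ℝ} (hg : Measurable g)
    (hb : ∃ M, ∀ x, g x ≤ M) (μ : Measure E) [IsFiniteMeasure μ] :
    IsFiniteMeasure (unnormStep K g μ) := by
  obtain ⟨M, hM⟩ := hb
  constructor
  rw [unnormStep_apply K hg _ MeasurableSet.univ]
  calc _ ≤ ∫⁻ x, ∫⁻ z in Set.univ, ENNReal.ofReal M ∂(K x) ∂μ :=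
        lintegral_mono fun x => lintegral_mono fun z => ENNReal.ofReal_le_ofReal (hM z)
    _ = ENNReal.ofReal M * μ Set.univ := by simp
    _ < ∞ := ENNReal.mul_lt_top ENNReal.ofReal_lt_top (measure_lt_top _ _)

lemma unnormStep_bounds {E : Type*} [MeasurableSpace E]
    (K : Kernel E E) {g : E → ℝ} (hg : Measurable g) {lam : Measure E} {ε : ℝ}
    (hmix : ∀ x : E, ∀ A : Set E, MeasurableSet A →
      ENNReal.ofReal ε * lam A ≤ K x A ∧ K x A ≤ ENNReal.ofReal ε⁻¹ * lam A)
    (μ : Measure E) {A : Set E} (hA : MeasurableSet A) :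
    ENNReal.ofReal ε * (∫⁻ z in A, ENNReal.ofReal (g z) ∂lam) * μ Set.univ
      ≤ unnormStep K g μ A ∧
    unnormStep K g μ A
      ≤ ENNReal.ofReal ε⁻¹ * (∫⁻ z in A, ENNReal.ofReal (g z) ∂lam) * μ Set.univ := by
  rw [unnormStep_apply K hg _ hA]
  have h1 : ∀ x, ENNReal.ofReal ε • lam ≤ K x := fun x =>
    Measure.le_iff.2 fun A hA => (hmix x A hA).1
  have h2 : ∀ x, K x ≤ ENNReal.ofReal ε⁻¹ • lam := fun x =>
    Measure.le_iff.2 fun A hA => (hmix x A hA).2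
  constructor
  · rw [← lintegral_const]
    refine lintegral_mono fun x => ?_
    rw [← smul_eq_mul, ← lintegral_smul_measure, ← Measure.restrict_smul]
    exact lintegral_mono' (Measure.restrict_mono le_rfl (h1 x)) le_rfl
  · rw [← lintegral_const]
    refine lintegral_mono fun x => ?_
    rw [← smul_eq_mul, ← lintegral_smul_measure, ← Measure.restrict_smul]
    exact lintegral_mono' (Measure.restrict_mono le_rfl (h2 x)) le_rfl

lemma unnormStep_ne_zero {E : Type*} [MeasurableSpace E]
    (K : Kernel E E) {g : E → ℝ} (hg : Measurable g) (hpos : ∀ x, 0 < g x)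
    {lam : Measure E} (hlam : lam ≠ 0) {ε : ℝ} (hε : 0 < ε)
    (hmix : ∀ x : E, ∀ A : Set E, MeasurableSet A →
      ENNReal.ofReal ε * lam A ≤ K x A ∧ K x A ≤ ENNReal.ofReal ε⁻¹ * lam A)
    {μ : Measure E} (hμ : μ ≠ 0) : unnormStep K g μ Set.univ ≠ 0 := by
  have h := (unnormStep_bounds K hg hmix μ MeasurableSet.univ).1
  intro h0
  rw [h0, nonpos_iff_eq_zero, mul_eq_zero, mul_eq_zero] at h
  rcases h with (h | h) | h
  · rw [ENNReal.ofReal_eq_zero] at h; linarith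
  · rw [Measure.restrict_univ, lintegral_eq_zero_iff hg.ennreal_ofReal] at h
    apply hlam
    rw [← ae_eq_bot, ← Filter.eventually_false_iff_eq_bot]
    filter_upwards [h] with x hx
    have := hpos x
    simp at hx
    linarith
  · exact hμ (Measure.measure_univ_eq_zero.1 h)

/-- One-step contraction for the unnormalized update. -/
lemma unnormStep_projRatio {E : Type*} [MeasurableSpace E]
    (K : Kernel E E) [IsMarkovKernel K] {g : E → ℝ} (hg : Measurable g)
    (hb : ∃ M, ∀ x, g x ≤ M)
    {lam : Measure E} [IsFiniteMeasure lam] {ε : ℝ} (hε : 0 < ε) (hε1 : ε ≤ 1)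
    (hmix : ∀ x : E, ∀ A : Set E, MeasurableSet A →
      ENNReal.ofReal ε * lam A ≤ K x A ∧ K x A ≤ ENNReal.ofReal ε⁻¹ * lam A)
    {μ ν : Measure E} [IsFiniteMeasure μ] [IsFiniteMeasure ν] (hμ : μ ≠ 0) {s : ℝ}
    (h : ProjRatio μ ν s) :
    ProjRatio (unnormStep K g μ) (unnormStep K g ν) (s ^ ((1 - ε ^ 2) / (1 + ε ^ 2))) := by
  obtain ⟨a, b, ha, hab, hs, H⟩ := h
  have hb0 : 0 < b := ha.trans_le hab
  have hs1 : 1 ≤ s := by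
    by_contra hc
    push Not at hc
    nlinarith
  have hfin : ∀ (m : Measure E) [IsFiniteMeasure m], IsFiniteMeasure (unnormStep K g m) :=
    fun m _ => unnormStep_finite K hg hb m
  lift a to ℝ≥0 using ha.le
  lift b to ℝ≥0 using hb0.le
  have l1 : a • μ ≤ ν := by
    refine Measure.le_iff.2 fun A hA => ?_
    have := (H A hA).1
    rw [← ENNReal.toReal_le_toReal (measure_ne_top _ _) (measure_ne_top _ _)]
    simpa [measureReal_def, ENNReal.toReal_mul] using this
  have l2 : ν ≤ b • μ := by
    refine Measure.le_iff.2 fun A hA => ?_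
    have := (H A hA).2
    rw [← ENNReal.toReal_le_toReal (measure_ne_top _ _) (measure_ne_top _ _)]
    simpa [measureReal_def, ENNReal.toReal_mul] using this
  obtain ⟨p, hpf, hp⟩ : ∃ p : Measure E, IsFiniteMeasure p ∧ p + a • μ = ν :=
    ⟨ν - a • μ, inferInstance, Measure.sub_add_cancel_of_le l1⟩
  obtain ⟨q, hqf, hq⟩ : ∃ q : Measure E, IsFiniteMeasure q ∧ q + ν = b • μ :=
    ⟨b • μ - ν, inferInstance, Measure.sub_add_cancel_of_le l2⟩
  have hmp : 0 < μ.real Set.univ := by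
    rw [measureReal_def, ENNReal.toReal_pos_iff]
    exact ⟨by simpa [pos_iff_ne_zero] using hμ, measure_lt_top _ _⟩
  have real_add : ∀ (m₁ m₂ : Measure E) [IsFiniteMeasure m₁] [IsFiniteMeasure m₂] (A : Set E),
      MeasurableSet A → (unnormStep K g (m₁ + m₂)).real A
        = (unnormStep K g m₁).real A + (unnormStep K g m₂).real A := by
    intro m₁ m₂ _ _ A hA
    have := hfin m₁
    have := hfin m₂
    rw [measureReal_def, unnormStep_add K hg _ _ hA,
      ENNReal.toReal_add (measure_ne_top _ _) (measure_ne_top _ _)]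
    rfl
  have real_smul : ∀ (c : ℝ≥0) (m : Measure E) (A : Set E),
      MeasurableSet A → (unnormStep K g (c • m)).real A = c * (unnormStep K g m).real A := by
    intro c m A hA
    rw [measureReal_def, unnormStep_smul K hg _ _ hA, ENNReal.toReal_mul]
    rfl
  set P := p.real Set.univ with hP
  set Q := q.real Set.univ with hQ
  have hP0 : 0 ≤ P := measureReal_nonneg
  have hQ0 : 0 ≤ Q := measureReal_nonneg
  have eP : ν.real Set.univ = P + a * μ.real Set.univ := by
    rw [← hp, measureReal_def, Measure.add_apply,
      ENNReal.toReal_add (measure_ne_top _ _) (measure_ne_top _ _)]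
    simp [hP, measureReal_def]
  have eQ : b * μ.real Set.univ = Q + ν.real Set.univ := by
    have : (b • μ).real Set.univ = Q + ν.real Set.univ := by
      rw [← hq, measureReal_def, Measure.add_apply,
        ENNReal.toReal_add (measure_ne_top _ _) (measure_ne_top _ _)]
      rfl
    rw [← this]
    simp [measureReal_def]
  have lamfin : ∀ A, (∫⁻ z in A, ENNReal.ofReal (g z) ∂lam) ≠ ∞ := by
    intro A
    obtain ⟨M, hM⟩ := hb
    refine ((lintegral_mono fun z => ENNReal.ofReal_le_ofReal (hM z)).trans_lt ?_).ne
    rw [lintegral_const]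
    exact ENNReal.mul_lt_top ENNReal.ofReal_lt_top (measure_lt_top _ _)
  have bnd : ∀ (m : Measure E) [IsFiniteMeasure m] (A : Set E), MeasurableSet A →
      ε * (∫⁻ z in A, ENNReal.ofReal (g z) ∂lam).toReal * m.real Set.univ
        ≤ (unnormStep K g m).real A ∧
      (unnormStep K g m).real A
        ≤ ε⁻¹ * (∫⁻ z in A, ENNReal.ofReal (g z) ∂lam).toReal * m.real Set.univ := by
    intro m _ A hA
    have := hfin m
    obtain ⟨h1, h2⟩ := unnormStep_bounds K hg hmix m hA
    constructor
    · have := ENNReal.toReal_mono (measure_ne_top _ _) h1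
      rwa [ENNReal.toReal_mul, ENNReal.toReal_mul, ENNReal.toReal_ofReal hε.le] at this
    · have := ENNReal.toReal_mono (ENNReal.mul_ne_top (ENNReal.mul_ne_top ENNReal.ofReal_ne_top
        (lamfin A)) (measure_ne_top _ _)) h2
      rwa [ENNReal.toReal_mul, ENNReal.toReal_mul,
        ENNReal.toReal_ofReal (inv_pos.2 hε).le] at this
  have dec : ∀ A, MeasurableSet A →
      (unnormStep K g ν).real A = (unnormStep K g p).real A + a * (unnormStep K g μ).real A ∧
      b * (unnormStep K g μ).real A = (unnormStep K g q).real A + (unnormStep K g ν).real A := by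
    intro A hA
    constructor
    · rw [← real_smul _ _ _ hA, ← real_add _ _ _ hA, hp]
    · rw [← real_smul _ _ _ hA, ← real_add _ _ _ hA, hq]
  have hr0 : 0 ≤ (1 - ε ^ 2) / (1 + ε ^ 2) := by
    apply div_nonneg <;> nlinarith
  have he0 : 0 < ε ^ 2 := by positivity
  have he1 : ε ^ 2 ≤ 1 := by nlinarith
  have hone : 1 ≤ s ^ ((1 - ε ^ 2) / (1 + ε ^ 2)) := Real.one_le_rpow hs1 hr0
  have cross : ∀ A, MeasurableSet A →
      ε ^ 2 * Q * (unnormStep K g p).real A ≤ P * (unnormStep K g q).real A ∧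
      ε ^ 2 * P * (unnormStep K g q).real A ≤ Q * (unnormStep K g p).real A := by
    intro A hA
    obtain ⟨p1, p2⟩ := bnd p A hA
    obtain ⟨q1, q2⟩ := bnd q A hA
    rw [← hP] at p1 p2
    rw [← hQ] at q1 q2
    set Λ := (∫⁻ z in A, ENNReal.ofReal (g z) ∂lam).toReal
    constructor
    · calc _ ≤ ε ^ 2 * Q * (ε⁻¹ * Λ * P) := by gcongr
        _ = P * (ε * Λ * Q) := by field_simp
        _ ≤ _ := by gcongr
    · calc _ ≤ ε ^ 2 * P * (ε⁻¹ * Λ * Q) := by gcongr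
        _ = Q * (ε * Λ * P) := by field_simp
        _ ≤ _ := by gcongr
  rcases hab.eq_or_lt with hab' | hab'
  · refine ⟨a, b, ha, hab, ?_, fun A hA => ?_⟩
    · rw [← hab']; nlinarith
    · obtain ⟨d1, d2⟩ := dec A hA
      constructor
      · rw [d1]; linarith [measureReal_nonneg (μ := unnormStep K g p) (s := A)]
      · rw [d2]; linarith [measureReal_nonneg (μ := unnormStep K g q) (s := A)]
  have hPQ : 0 < P + Q := by nlinarith
  set e := ε ^ 2 with he
  have D1 : 0 < e * P + Q := by
    rcases hP0.eq_or_lt with h | h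
    · rw [← h] at hPQ ⊢; linarith
    · positivity
  have D2 : 0 < P + e * Q := by
    rcases hQ0.eq_or_lt with h | h
    · rw [← h] at hPQ ⊢; linarith
    · positivity
  have N1 : 0 < b * e * P + a * Q := by
    have : (a : ℝ) * (e * P + Q) ≤ b * e * P + a * Q := by
      have : (a : ℝ) * (e * P) ≤ b * (e * P) := by gcongr
      linarith
    exact (mul_pos ha D1).trans_le this
  refine ⟨(b * e * P + a * Q) / (e * P + Q), (b * P + a * (e * Q)) / (P + e * Q),
    div_pos N1 D1, ?_, ?_, fun A hA => ?_⟩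
  · rw [div_le_div_iff₀ D1 D2]
    have : 0 ≤ (b - a : ℝ) * (1 - e ^ 2) * (P * Q) := by
      apply mul_nonneg (mul_nonneg (by linarith) (by nlinarith)) (by positivity)
    nlinarith
  · have sc := birkhoff_scalar he0 he1 (s := (b : ℝ) / a) ((one_le_div ha).2 hab) hP0 hQ0 hPQ
    have hmono : ((b : ℝ) / a) ^ ((1 - e) / (1 + e)) ≤ s ^ ((1 - e) / (1 + e)) :=
      Real.rpow_le_rpow (by positivity) ((div_le_iff₀ ha).2 hs) hr0
    rw [← mul_div_assoc, div_le_div_iff₀ D2 D1]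
    have N1' : 0 < (b : ℝ) / a * e * P + Q := by
      have : (b : ℝ) / a * e * P + Q = (b * e * P + a * Q) / a := by field_simp
      rw [this]; positivity
    have sc2 : ((b : ℝ) / a * P + e * Q) * (e * P + Q) ≤ s ^ ((1 - e) / (1 + e)) *
        ((P + e * Q) * ((b : ℝ) / a * e * P + Q)) :=
      sc.trans (mul_le_mul_of_nonneg_right hmono (by positivity))
    have := mul_le_mul_of_nonneg_left sc2 ha.le
    calc _ = (a : ℝ) * (((b : ℝ) / a * P + e * Q) * (e * P + Q)) := by field_simp
      _ ≤ _ := this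
      _ = _ := by field_simp
  · obtain ⟨d1, d2⟩ := dec A hA
    obtain ⟨c1, c2⟩ := cross A hA
    set M := (unnormStep K g μ).real A
    set N := (unnormStep K g ν).real A
    set x := (unnormStep K g p).real A
    set y := (unnormStep K g q).real A
    have hx : x = N - a * M := by linarith
    have hy : y = b * M - N := by linarith
    rw [hx, hy] at c1 c2
    rw [div_mul_eq_mul_div, div_mul_eq_mul_div, div_le_iff₀ D1, le_div_iff₀ D2]
    constructor <;> linarith

lemma projRatio_smul {E : Type*} [MeasurableSpace E] {μ ν : Measure E} {s : ℝ}
    (h : ProjRatio μ ν s) {c d : ℝ≥0∞} (hc : 0 < c.toReal) (hd : 0 < d.toReal) :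
    ProjRatio (c • μ) (d • ν) s := by
  obtain ⟨a, b, ha, hab, hs, H⟩ := h
  refine ⟨a * (d.toReal / c.toReal), b * (d.toReal / c.toReal), by positivity, by gcongr, ?_, ?_⟩
  · rw [← mul_assoc]; gcongr
  · intro A hA
    obtain ⟨h1, h2⟩ := H A hA
    rw [measureReal_ennreal_smul_apply, measureReal_ennreal_smul_apply]
    constructor
    · calc _ = d.toReal * (a * μ.real A) := by field_simp
        _ ≤ _ := by gcongr
    · calc _ ≤ d.toReal * (b * μ.real A) := by gcongr
        _ = _ := by field_simp

theorem filter_composition_contraction {E : Type*} [MeasurableSpace E]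
    (K : Kernel E E) [IsMarkovKernel K] (ε : ℝ) (hε0 : 0 < ε) (hε1 : ε ≤ 1)
    (hmix : IsMixing K ε) (g : ℕ → E → ℝ)
    (hgm : ∀ j, Measurable (g j)) (hgpos : ∀ j x, 0 < g j x)
    (hgbdd : ∀ j, ∃ M, ∀ x, g j x ≤ M) :
    ∀ k n : ℕ, k ≤ n →
      birkhoffCoeff (filterComp K g k n) ≤ ((1 - ε ^ 2) / (1 + ε ^ 2)) ^ (n - k) := by
  intro k n _
  obtain ⟨lam, hlf, hl0, hm⟩ := hmix
  set r := (1 - ε ^ 2) / (1 + ε ^ 2) with hr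
  have hr0 : 0 ≤ r := by
    apply div_nonneg <;> nlinarith
  have step : ∀ (j : ℕ) (μ : Measure E), IsFiniteMeasure μ → μ ≠ 0 →
      IsFiniteMeasure (filterStep K (g j) μ) ∧ filterStep K (g j) μ ≠ 0 ∧
      0 < ((unnormStep K (g j) μ Set.univ)⁻¹).toReal := by
    intro j μ hμ hμ0
    have hf := unnormStep_finite K (hgm j) (hgbdd j) μ
    have h0 := unnormStep_ne_zero K (hgm j) (hgpos j) hl0 hε0 hm hμ0
    have ht : unnormStep K (g j) μ Set.univ ≠ ∞ := measure_ne_top _ _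
    have hu : filterStep K (g j) μ Set.univ = 1 := by
      change (unnormStep K (g j) μ Set.univ)⁻¹ * unnormStep K (g j) μ Set.univ = 1
      exact ENNReal.inv_mul_cancel h0 ht
    refine ⟨⟨by rw [hu]; exact ENNReal.one_lt_top⟩, ?_, ?_⟩
    · intro h
      rw [h] at hu
      simp at hu
    · exact ENNReal.toReal_pos (ENNReal.inv_ne_zero.2 ht) (ENNReal.inv_ne_top.2 h0)
  have main : ∀ (μ ν : Measure E) (s : ℝ), IsFiniteMeasure μ → IsFiniteMeasure ν → μ ≠ 0 →
      ν ≠ 0 → 0 < s → ProjRatio μ ν s → ∀ N : ℕ,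
      let T := fun m => (List.range N).foldl (fun m j => filterStep K (g (k + 1 + j)) m) m
      IsFiniteMeasure (T μ) ∧ IsFiniteMeasure (T ν) ∧ T μ ≠ 0 ∧ T ν ≠ 0 ∧
        ProjRatio (T μ) (T ν) (s ^ (r ^ N)) := by
    intro μ ν s hμ hν hμ0 hν0 hs h N
    induction N with
    | zero => simpa using ⟨hμ, hν, hμ0, hν0, h⟩
    | succ N ih =>
      simp only [List.range_succ, List.foldl_append, List.foldl_cons, List.foldl_nil] at ih ⊢
      set μ' := (List.range N).foldl (fun m j => filterStep K (g (k + 1 + j)) m) μ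
      set ν' := (List.range N).foldl (fun m j => filterStep K (g (k + 1 + j)) m) ν
      obtain ⟨i1, i2, i3, i4, i5⟩ := ih
      obtain ⟨a1, a2, a3⟩ := step (k + 1 + N) μ' i1 i3
      obtain ⟨b1, b2, b3⟩ := step (k + 1 + N) ν' i2 i4
      refine ⟨a1, b1, a2, b2, ?_⟩
      rw [pow_succ, Real.rpow_mul hs.le]
      exact projRatio_smul (unnormStep_projRatio K (hgm _) (hgbdd _) hε0 hε1 hm i3 i5) a3 b3
  refine Real.sSup_le ?_ (pow_nonneg hr0 _)
  rintro _ ⟨μ, ν, hμ, hν, -, hpos, rfl⟩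
  obtain ⟨h1, h2, h3⟩ := projRatio_of_hilbertDist_pos hpos
  obtain ⟨i1, i2, -, -, i5⟩ := main μ ν _ hμ hν h2 h3 (Real.exp_pos _) h1 (n - k)
  rw [div_le_iff₀ hpos]
  have := hilbertDist_le_of_projRatio i5
  rw [Real.log_rpow (Real.exp_pos _), Real.log_exp] at this
  exact this
end
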